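/- Let p be a prime and q = p^n > 3. Let V be a finite perfect group with a nontrivial normal elementary abelian p-subgroup N such that V/N is isomorphic to SL_2(F_q) or to PSL_2(F_q). Suppose that for every group homomorphism λ : N → ℂ^× there exists a Sylow p-subgroup R of V (depending on λ) such that λ extends to a group homomorphism R → ℂ^×. Then there exist a Sylow p-subgroup Q of V and an irreducible complex character of Q of degree |Q : N|; in particular Q has an irreducible character of degree q > 1. -/

import Mathlib

open CategoryTheory

/-- `PSL₂(F)`: the quotient of `SL₂(F)` by its center. -/
abbrev PSL2 (F : Type*) [Field F] :=
  Matrix.SpecialLinearGroup (Fin 2) F ⧸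
    Subgroup.center (Matrix.SpecialLinearGroup (Fin 2) F)

section InducedCharacter

/-- The one-dimensional representation attached to a linear character. -/
noncomputable def linearCharacterRep {N : Type*} [Group N] (lam : N →* ℂˣ) :
    Representation ℂ N ℂ :=
  (Algebra.lmul ℂ ℂ).toMonoidHom.comp ((Units.coeHom ℂ).comp lam)

lemma linearCharacterRep_apply {N : Type*} [Group N] (lam : N →* ℂˣ) (n : N) (z : ℂ) :
    linearCharacterRep lam n z = lam n * z := rfl

/-- Functions in the representation induced from a linear character of `N` are determined by
their values on a transversal of `N`. -/
noncomputable def coindLinearCharacterEquiv {G : Type*} [Group G] (N : Subgroup G)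
    (lam : N →* ℂˣ) :
    Representation.coindV N.subtype (linearCharacterRep lam) ≃ₗ[ℂ] (G ⧸ N → ℂ) where
  toFun f q := f.1 q.out⁻¹
  map_add' _ _ := rfl
  map_smul' _ _ := rfl
  invFun h := ⟨fun x => lam ⟨x * ((x⁻¹ : G) : G ⧸ N).out, by
      have := (QuotientGroup.eq (s := N)).1 (Quotient.out_eq' ((x⁻¹ : G) : G ⧸ N)).symm
      rwa [inv_inv] at this⟩ * h ((x⁻¹ : G) : G ⧸ N), by
    intro n x
    have hq : (((n * x : G)⁻¹ : G) : G ⧸ N) = ((x⁻¹ : G) : G ⧸ N) := by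
      rw [QuotientGroup.eq]; simp
    simp only [Subgroup.subtype_apply, linearCharacterRep_apply]
    rw [← mul_assoc, ← Units.val_mul, ← map_mul]
    refine congrArg₂ _ (congrArg _ (congrArg _ (Subtype.ext ?_))) (congrArg h hq)
    change n * x * _ = n * (x * _)
    rw [hq, mul_assoc]⟩
  left_inv f := by
    ext x
    have hx : x * ((x⁻¹ : G) : G ⧸ N).out ∈ N := by
      have := (QuotientGroup.eq (s := N)).1 (Quotient.out_eq' ((x⁻¹ : G) : G ⧸ N)).symm
      rwa [inv_inv] at this
    have := f.2 ⟨_, hx⟩ (((x⁻¹ : G) : G ⧸ N).out⁻¹)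
    simp only [Subgroup.subtype_apply, linearCharacterRep_apply, mul_inv_cancel_right] at this
    exact this.symm
  right_inv h := by
    ext q
    have h1 : (((q.out⁻¹)⁻¹ : G) : G ⧸ N) = q := by simp
    have h2 : ∀ hm, lam ⟨q.out⁻¹ * (((q.out⁻¹)⁻¹ : G) : G ⧸ N).out, hm⟩ = 1 := by
      rw [h1]
      intro hm
      convert map_one lam
      simp
    change ((lam _ : ℂˣ) : ℂ) * h (((q.out⁻¹)⁻¹ : G) : G ⧸ N) = h q
    rw [h2, h1, Units.val_one, one_mul]

/-- If only the elements of the finite normal subgroup `N` fix the linear character `lam` of `N`,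
then the representation induced from `lam` is irreducible, of degree the index of `N`. -/
theorem exists_simple_finrank_eq_index (G : Type) [Group G] [Finite G] (N : Subgroup G) [N.Normal]
    (lam : N →* ℂˣ)
    (h : ∀ g : G, (∀ (n : G) (hn : n ∈ N) (hn' : g * n * g⁻¹ ∈ N),
      lam ⟨g * n * g⁻¹, hn'⟩ = lam ⟨n, hn⟩) → g ∈ N) :
    ∃ W : FDRep ℂ G, Simple W ∧ Module.finrank ℂ W = N.index := by
  classical
  cases nonempty_fintype G
  let V := Representation.coindV N.subtype (linearCharacterRep lam)
  let ρ : Representation ℂ G V := Representation.coind N.subtype (linearCharacterRep lam)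
  have hρ : ∀ (g : G) (f : V) (x : G), (ρ g f).1 x = f.1 (x * g) := fun _ _ _ => rfl
  have hV : ∀ (f : V) (n : G) (hn : n ∈ N) (x : G), f.1 (n * x) = lam ⟨n, hn⟩ * f.1 x :=
    fun f n hn x => f.2 ⟨n, hn⟩ x
  have hfin : Module.finrank ℂ V = N.index := by
    rw [(coindLinearCharacterEquiv N lam).finrank_eq, Module.finrank_pi_fintype,
      Subgroup.index, Nat.card_eq_fintype_card]
    simp
  refine ⟨FDRep.of ρ, ?_, hfin⟩
  have : NeZero (Nat.card G : ℂ) := ⟨Nat.cast_ne_zero.2 Nat.card_pos.ne'⟩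
  rw [FDRep.simple_iff_end_is_rank_one]
  let v : V := ⟨fun x => if hx : x ∈ N then lam ⟨x, hx⟩ else 0, by
    rintro ⟨n, hn⟩ x
    rw [linearCharacterRep_apply]
    beta_reduce
    by_cases hx : x ∈ N
    · rw [dif_pos hx, dif_pos (show N.subtype ⟨n, hn⟩ * x ∈ N from N.mul_mem hn hx), ← Units.val_mul, ← map_mul]; rfl
    · rw [dif_neg hx, dif_neg (show N.subtype ⟨n, hn⟩ * x ∉ N from
        fun hh => hx ((N.mul_mem_cancel_left hn).1 hh)), mul_zero]⟩
  have hv1 : v.1 1 = 1 := by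
    have : lam (⟨1, N.one_mem⟩ : N) = 1 := map_one lam
    simp [v, this]
  have hv0 : ∀ x, x ∉ N → v.1 x = 0 := fun x hx => by simp [v, hx]
  have hvN : ∀ x (hx : x ∈ N), v.1 x = lam ⟨x, hx⟩ := fun x hx => by simp [v, hx]
  -- functions on which `N` acts through `lam` are multiples of `v`
  have key : ∀ f : V, (∀ n (hn : n ∈ N), ρ n f = (lam ⟨n, hn⟩ : ℂ) • f) →
      f = f.1 1 • v := by
    intro f hf
    ext x
    change f.1 x = f.1 1 * v.1 x
    by_cases hx : x ∈ N
    · rw [hvN x hx]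
      have := hV f x hx 1
      rw [mul_one] at this
      rw [this, mul_comm]
    · rw [hv0 x hx, mul_zero]
      by_contra hne
      refine hx (h x fun n hn hn' => ?_)
      have h1 : f.1 (x * n) = lam ⟨n, hn⟩ * f.1 x := by
        rw [← hρ, hf n hn]; rfl
      have h2 := hV f (x * n * x⁻¹) hn' x
      rw [inv_mul_cancel_right, h1] at h2
      exact Units.ext (mul_right_cancel₀ hne h2).symm
  have hgen : ∀ f : V, f = (Nat.card N : ℂ)⁻¹ • ∑ x : G, f.1 x • ρ x⁻¹ v := by
    intro f
    rw [eq_inv_smul_iff₀ (Nat.cast_ne_zero.2 Nat.card_pos.ne')]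
    ext y
    simp only [Submodule.coe_sum, Finset.sum_apply, Submodule.coe_smul, Pi.smul_apply, smul_eq_mul]
    have hterm : ∀ x, f.1 x * (ρ x⁻¹ v).1 y = if y * x⁻¹ ∈ N then f.1 y else 0 := by
      intro x
      rw [hρ]
      split_ifs with hx
      · rw [hvN _ hx]
        have := hV f _ hx x
        rw [inv_mul_cancel_right] at this
        rw [this, mul_comm]
      · rw [hv0 _ hx, mul_zero]
    rw [Finset.sum_congr rfl fun x _ => hterm x]
    have e : (∑ x : G, if y * x⁻¹ ∈ N then f.1 y else 0) = ∑ x : G, if x ∈ N then f.1 y else 0 :=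
      Fintype.sum_equiv ((Equiv.inv G).trans (Equiv.mulLeft y)) _ _ fun x => rfl
    rw [e, Finset.sum_ite, Finset.sum_const_zero, add_zero, Finset.sum_const, nsmul_eq_mul]
    congr 2
    rw [Nat.card_eq_fintype_card, Fintype.card_subtype]
  have hvlam : ∀ n (hn : n ∈ N), ρ n v = (lam ⟨n, hn⟩ : ℂ) • v := by
    intro n hn
    ext x
    change v.1 (x * n) = lam ⟨n, hn⟩ * v.1 x
    by_cases hx : x ∈ N
    · rw [hvN x hx, hvN _ (N.mul_mem hx hn), mul_comm, ← Units.val_mul, ← map_mul]; rfl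
    · rw [hv0 x hx, hv0 _ (fun hh => hx ((N.mul_mem_cancel_right hn).1 hh)), mul_zero]
  rw [finrank_eq_one_iff_of_nonzero' (𝟙 (FDRep.of ρ))]
  · intro T
    let t : V →ₗ[ℂ] V := T.hom.hom.hom
    have ht : ∀ g f, t (ρ g f) = ρ g (t f) := fun g f =>
      ConcreteCategory.congr_hom ((forget (FGModuleCat ℂ)).congr_map (T.comm g)) f
    have htv : t v = (t v).1 1 • v := key _ fun n hn => by rw [← ht, hvlam n hn, map_smul]
    refine ⟨(t v).1 1, ?_⟩
    ext f x
    refine congrFun (congrArg Subtype.val (?_ : (t v).1 1 • (f : V) = t f)) x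
    rw [hgen f]
    simp only [map_smul, map_sum, ht]
    rw [smul_comm, Finset.smul_sum]
    conv_rhs => rw [htv]
    simp only [map_smul]
    congr 1
    exact Finset.sum_congr rfl fun x _ => smul_comm _ _ _
  · intro h0
    have : (v : V) = 0 :=
      ConcreteCategory.congr_hom ((forget (FGModuleCat ℂ)).congr_map (congrArg Action.Hom.hom h0)) v
    rw [this] at hv1
    exact zero_ne_one hv1

end InducedCharacter

section SpecialLinear

open Matrix

variable {F : Type*} [Field F]

/-- The upper unipotent one-parameter subgroup of `SL₂(F)`. -/
def upperUnipotent : Multiplicative F →* SpecialLinearGroup (Fin 2) F where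
  toFun a := ⟨!![1, a.toAdd; 0, 1], by simp⟩
  map_one' := by ext i j; fin_cases i <;> fin_cases j <;> simp
  map_mul' a b := Subtype.ext <| by
    change !![1, (a * b).toAdd; 0, 1] = !![1, a.toAdd; 0, 1] * !![1, b.toAdd; 0, 1]
    simp [add_comm]

/-- The lower unipotent one-parameter subgroup of `SL₂(F)`. -/
def lowerUnipotent : Multiplicative F →* SpecialLinearGroup (Fin 2) F where
  toFun a := ⟨!![1, 0; a.toAdd, 1], by simp⟩
  map_one' := by ext i j; fin_cases i <;> fin_cases j <;> simp
  map_mul' a b := Subtype.ext <| by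
    change !![1, 0; (a * b).toAdd, 1] = !![1, 0; a.toAdd, 1] * !![1, 0; b.toAdd, 1]
    simp

lemma coe_upperUnipotent (a : Multiplicative F) :
    (upperUnipotent a : Matrix (Fin 2) (Fin 2) F) = !![1, a.toAdd; 0, 1] := rfl

lemma coe_lowerUnipotent (a : Multiplicative F) :
    (lowerUnipotent a : Matrix (Fin 2) (Fin 2) F) = !![1, 0; a.toAdd, 1] := rfl

lemma upperUnipotent_injective : Function.Injective (upperUnipotent (F := F)) := by
  intro a b h
  have := congrArg (fun A : SpecialLinearGroup (Fin 2) F => A.1 0 1) h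
  simpa [coe_upperUnipotent] using this

lemma lowerUnipotent_injective : Function.Injective (lowerUnipotent (F := F)) := by
  intro a b h
  have := congrArg (fun A : SpecialLinearGroup (Fin 2) F => A.1 1 0) h
  simpa [coe_lowerUnipotent] using this

lemma eq_one_of_lowerUnipotent_mem_center {a : Multiplicative F}
    (h : lowerUnipotent a ∈ Subgroup.center (SpecialLinearGroup (Fin 2) F)) : a = 1 := by
  have := Subgroup.mem_center_iff.1 h (upperUnipotent (.ofAdd 1))
  have := congrArg (fun A : SpecialLinearGroup (Fin 2) F => A.1 0 0) this
  simpa [coe_lowerUnipotent, coe_upperUnipotent, Matrix.mul_apply, Fin.sum_univ_two] using this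

/-- A matrix with nonzero lower left entry is a product of unipotents. -/
lemma eq_upper_mul_lower_mul_upper (A : SpecialLinearGroup (Fin 2) F) (h : A.1 1 0 ≠ 0) :
    A = upperUnipotent (.ofAdd ((A.1 0 0 - 1) / A.1 1 0)) * lowerUnipotent (.ofAdd (A.1 1 0)) *
      upperUnipotent (.ofAdd ((A.1 1 1 - 1) / A.1 1 0)) := by
  have hdet := A.2
  rw [Matrix.det_fin_two] at hdet
  ext i j
  fin_cases i <;> fin_cases j <;>
    simp [coe_lowerUnipotent, coe_upperUnipotent, Matrix.mul_apply, Fin.sum_univ_two]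
  · field_simp; ring
  · field_simp; linear_combination -hdet
  · field_simp; ring

/-- The upper unipotents together with one nontrivial lower unipotent generate `SL₂(F)`. -/
lemma eq_top_of_upperUnipotent_le_of_lowerUnipotent_mem
    (T : Subgroup (SpecialLinearGroup (Fin 2) F)) (hU : upperUnipotent.range ≤ T)
    {c : Multiplicative F} (hc : c ≠ 1) (hT : lowerUnipotent c ∈ T) : T = ⊤ := by
  have hu : ∀ a, upperUnipotent a ∈ T := fun a => hU ⟨a, rfl⟩
  have hc0 : c.toAdd ≠ 0 := fun h => hc (by simpa using h)
  set w := upperUnipotent (.ofAdd (-(c.toAdd)⁻¹)) * lowerUnipotent c *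
    upperUnipotent (.ofAdd (-(c.toAdd)⁻¹)) with hw
  have hwT : w ∈ T := T.mul_mem (T.mul_mem (hu _) hT) (hu _)
  have hwm : w.1 = !![0, -(c.toAdd)⁻¹; c.toAdd, 0] := by
    ext i j
    fin_cases i <;> fin_cases j <;>
      simp [hw, coe_lowerUnipotent, coe_upperUnipotent, Matrix.mul_apply, Fin.sum_univ_two, hc0]
  have hl : ∀ a, lowerUnipotent a ∈ T := by
    intro a
    have : lowerUnipotent a * w =
        w * upperUnipotent (.ofAdd (-a.toAdd * (c.toAdd)⁻¹ * (c.toAdd)⁻¹)) := by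
      ext i j
      fin_cases i <;> fin_cases j <;>
        simp [hwm, coe_lowerUnipotent, coe_upperUnipotent, Matrix.mul_apply, Fin.sum_univ_two]
      field_simp
    exact (T.mul_mem_cancel_right hwT).1 (this ▸ T.mul_mem hwT (hu _))
  have hA : ∀ A : SpecialLinearGroup (Fin 2) F, A.1 1 0 ≠ 0 → A ∈ T := by
    intro A h
    rw [eq_upper_mul_lower_mul_upper A h]
    exact T.mul_mem (T.mul_mem (hu _) (hl _)) (hu _)
  rw [eq_top_iff]
  intro A _
  by_cases h : A.1 1 0 = 0
  · have hdet := A.2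
    rw [Matrix.det_fin_two, h] at hdet
    refine (T.mul_mem_cancel_left (hl (.ofAdd 1))).1 (hA _ ?_)
    intro h'
    change ((lowerUnipotent (.ofAdd (1 : F))).1 * A.1) 1 0 = 0 at h'
    rw [coe_lowerUnipotent, Matrix.mul_apply, Fin.sum_univ_two] at h'
    simp [h] at h'
    simp [h'] at hdet
  · exact hA A h

lemma card_specialLinearGroup_two [Fintype F] :
    Nat.card (SpecialLinearGroup (Fin 2) F) = Fintype.card F * (Fintype.card F ^ 2 - 1) := by
  classical
  have h1 := Matrix.card_GL_field (𝔽 := F) 2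
  have hker : (GeneralLinearGroup.det (n := Fin 2) (R := F)).ker =
      (SpecialLinearGroup.toGL (n := Fin 2) (R := F)).range := by
    ext A
    constructor
    · intro hA
      refine ⟨⟨A.1, ?_⟩, ?_⟩
      · exact congrArg Units.val hA
      · ext; rfl
    · rintro ⟨B, rfl⟩
      exact Units.ext B.2
  have hsurj : (GeneralLinearGroup.det (n := Fin 2) (R := F)).range = ⊤ := by
    rw [MonoidHom.range_eq_top]
    intro u
    refine ⟨GeneralLinearGroup.mkOfDetNeZero !![(u : F), 0; 0, 1] (by simp), ?_⟩
    ext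
    simp [GeneralLinearGroup.mkOfDetNeZero]
  have h2 := (GeneralLinearGroup.det (n := Fin 2) (R := F)).ker.card_mul_index
  rw [Subgroup.index_ker, hsurj, Subgroup.card_top, Nat.card_units, hker,
    ← Nat.card_congr (MonoidHom.ofInjective SpecialLinearGroup.toGL_injective).toEquiv, h1,
    Nat.card_eq_fintype_card (α := F)] at h2
  have hq : 1 < Fintype.card F := Fintype.one_lt_card
  simp only [Fin.prod_univ_two, Fin.val_zero, Fin.val_one, pow_zero, pow_one] at h2
  refine Nat.eq_of_mul_eq_mul_right (Nat.sub_pos_of_lt hq) (h2.trans ?_)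
  have : Fintype.card F ^ 2 - Fintype.card F = Fintype.card F * (Fintype.card F - 1) := by
    rw [Nat.mul_sub, mul_one, sq]
  rw [this]
  ring

lemma not_dvd_index_range [Fintype F] {p n : ℕ} (hp : p.Prime) (hn : n ≠ 0)
    (hF : Fintype.card F = p ^ n) (f : Multiplicative F →* SpecialLinearGroup (Fin 2) F)
    (hf : Function.Injective f) : ¬ p ∣ f.range.index := by
  have h := f.range.card_mul_index
  rw [card_specialLinearGroup_two, ← Nat.card_congr (MonoidHom.ofInjective hf).toEquiv,
    Nat.card_congr Multiplicative.toAdd, Nat.card_eq_fintype_card] at h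
  rw [Nat.eq_of_mul_eq_mul_left Fintype.card_pos h, hF]
  intro hd
  have h1 : p ∣ (p ^ n) ^ 2 := dvd_pow (dvd_pow_self p hn) two_ne_zero
  have h2 : 1 ≤ (p ^ n) ^ 2 := Nat.one_le_pow _ _ (pow_pos hp.pos _)
  exact hp.one_lt.ne' (Nat.dvd_one.1 ((Nat.dvd_sub_iff_right h2 h1).1 hd))

end SpecialLinear

section CentralSubgroup

/-- Linear characters separate the elements of a finite commutative subgroup. -/
lemma exists_linearCharacter_ne_one {N : Type*} [Group N] [Finite N]
    (hab : ∀ a b : N, a * b = b * a) {a : N} (ha : a ≠ 1) : ∃ lam : N →* ℂˣ, lam a ≠ 1 := by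
  let _ : CommGroup N := { (inferInstance : Group N) with mul_comm := hab }
  exact CommGroup.exists_apply_ne_one_of_hasEnoughRootsOfUnity N ℂ ha

/-- In a finite perfect group, a central element of a subgroup `R` whose order is coprime to the
index of `R` is killed by all linear characters of `R`. -/
lemma linearCharacter_eq_one_of_mem_center {V : Type*} [Group V] [Finite V]
    (hperf : commutator V = ⊤) (R : Subgroup V) (mu : R →* ℂˣ) {m : V} (hm : m ∈ R)
    (hc : m ∈ Subgroup.center V) {p : ℕ} (hmp : m ^ p = 1) (hR : Nat.Coprime p R.index) :
    mu ⟨m, hm⟩ = 1 := by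
  have htriv : MonoidHom.transfer mu m = 1 := by
    have : commutator V ≤ (MonoidHom.transfer mu).ker := Abelianization.commutator_subset_ker _
    rw [hperf] at this
    exact this (Subgroup.mem_top m)
  rw [MonoidHom.transfer_eq_pow mu m fun k g₀ _ => by
    rw [mul_assoc, ← Subgroup.mem_center_iff.1 (Subgroup.pow_mem _ hc k) g₀,
      inv_mul_cancel_left]] at htriv
  have h1 : mu ⟨m, hm⟩ ^ R.index = 1 := by
    rw [← htriv, ← map_pow]; rfl
  have h2 : mu ⟨m, hm⟩ ^ p = 1 := by
    have : (⟨m, hm⟩ : R) ^ p = 1 := Subtype.ext hmp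
    rw [← map_pow, this, map_one]
  have h3 := Nat.dvd_gcd (orderOf_dvd_of_pow_eq_one h2) (orderOf_dvd_of_pow_eq_one h1)
  rw [hR] at h3
  exact orderOf_eq_one_iff.1 (Nat.dvd_one.1 h3)

/-- The inertia group of a linear character of a normal subgroup. -/
def inertiaSubgroup {V : Type*} [Group V] (N : Subgroup V) [N.Normal] (lam : N →* ℂˣ) :
    Subgroup V where
  carrier := {g | lam.comp (MulAut.conjNormal g).toMonoidHom = lam}
  one_mem' := by ext; simp
  mul_mem' {a b} ha hb := by
    ext x
    have h1 := DFunLike.congr_fun ha (MulAut.conjNormal b x)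
    have h2 := DFunLike.congr_fun hb x
    simp only [MonoidHom.comp_apply, MulEquiv.coe_toMonoidHom] at h1 h2
    simp [h1, h2]
  inv_mem' {a} ha := by
    ext x
    have h1 := DFunLike.congr_fun ha (MulAut.conjNormal a⁻¹ x)
    simp only [MonoidHom.comp_apply, MulEquiv.coe_toMonoidHom, map_inv, MulAut.apply_inv_self] at h1
    simp [h1]

lemma mem_inertiaSubgroup {V : Type*} [Group V] {N : Subgroup V} [N.Normal] {lam : N →* ℂˣ}
    {g : V} : g ∈ inertiaSubgroup N lam ↔ ∀ n, lam (MulAut.conjNormal g n) = lam n :=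
  DFunLike.ext_iff

lemma le_inertiaSubgroup {V : Type*} [Group V] {N : Subgroup V} [N.Normal] {lam : N →* ℂˣ}
    {R : Subgroup V} (hNR : N ≤ R) (mu : R →* ℂˣ) (h : ∀ m : N, mu ⟨m, hNR m.2⟩ = lam m) :
    R ≤ inertiaSubgroup N lam := by
  intro g hg
  rw [mem_inertiaSubgroup]
  intro n
  rw [← h, ← h]
  have : (⟨(MulAut.conjNormal g n : N), hNR (MulAut.conjNormal g n).2⟩ : R) =
      ⟨g, hg⟩ * ⟨n, hNR n.2⟩ * ⟨g, hg⟩⁻¹ := Subtype.ext (MulAut.conjNormal_apply g n)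
  rw [this, map_mul, map_mul, map_inv, mul_right_comm, mul_inv_cancel, one_mul]

/-- If every linear character of the nontrivial normal elementary abelian `p`-subgroup `N` of a
finite perfect group extends to a Sylow `p`-subgroup, some linear character is not invariant. -/
lemma exists_inertiaSubgroup_ne_top {V : Type*} [Group V] [Finite V] {p : ℕ} (hp : p.Prime)
    (hperf : commutator V = ⊤) (N : Subgroup V) [N.Normal] (hNnt : N ≠ ⊥)
    (hNab : ∀ a b : N, a * b = b * a) (hNelem : ∀ a : N, a ^ p = 1)
    (hext : ∀ lam : N →* ℂˣ, ∃ (R : Sylow p V) (hNR : N ≤ (R : Subgroup V))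
      (mu : (R : Subgroup V) →* ℂˣ), ∀ m : N, mu ⟨m, hNR m.2⟩ = lam m) :
    ∃ lam : N →* ℂˣ, inertiaSubgroup N lam ≠ ⊤ := by
  have : Fact p.Prime := ⟨hp⟩
  by_contra! hinv
  have hcent : N ≤ Subgroup.center V := by
    intro m hm
    rw [Subgroup.mem_center_iff]
    intro g
    have : MulAut.conjNormal g ⟨m, hm⟩ = (⟨m, hm⟩ : N) := by
      by_contra hne
      obtain ⟨lam, hlam⟩ := exists_linearCharacter_ne_one hNab (mul_inv_eq_one.not.2 hne)
      have := mem_inertiaSubgroup.1 (hinv lam ▸ Subgroup.mem_top g) ⟨m, hm⟩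
      exact hlam (by rw [map_mul, map_inv, this, mul_inv_cancel])
    have := congrArg Subtype.val this
    rw [MulAut.conjNormal_apply] at this
    exact mul_inv_eq_iff_eq_mul.1 this
  obtain ⟨m, hm1⟩ := Subgroup.ne_bot_iff_exists_ne_one.1 hNnt
  obtain ⟨lam, hlam⟩ := exists_linearCharacter_ne_one hNab hm1
  obtain ⟨R, hNR, mu, hmu⟩ := hext lam
  refine hlam ?_
  rw [← hmu]
  refine linearCharacter_eq_one_of_mem_center hperf _ mu _ (hcent m.2)
    (congrArg Subtype.val (hNelem m)) ?_
  exact (Nat.Prime.coprime_iff_not_dvd hp).2 R.not_dvd_index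

end CentralSubgroup

section QuotientSpecialLinear

variable {F : Type*} [Field F] {V : Type*} [Group V] {N : Subgroup V} [N.Normal]
  (phi : Matrix.SpecialLinearGroup (Fin 2) F →* V ⧸ N)

/-- The preimage in `V` of the image in `V ⧸ N` of a unipotent subgroup of `SL₂(F)`. -/
def unipotentPreimage (f : Multiplicative F →* Matrix.SpecialLinearGroup (Fin 2) F) :
    Subgroup V :=
  (f.range.map phi).comap (QuotientGroup.mk' N)

lemma not_dvd_index_unipotentPreimage [Fintype F] {p n : ℕ} (hp : p.Prime) (hn : n ≠ 0)
    (hF : Fintype.card F = p ^ n) (hphi : Function.Surjective phi)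
    {f : Multiplicative F →* Matrix.SpecialLinearGroup (Fin 2) F} (hf : Function.Injective f) :
    ¬ p ∣ (unipotentPreimage phi f).index := by
  rw [unipotentPreimage, Subgroup.index_comap_of_surjective _ (QuotientGroup.mk'_surjective N)]
  exact fun h => not_dvd_index_range hp hn hF f hf (h.trans (Subgroup.index_map_dvd _ hphi))

lemma isPGroup_unipotentPreimage [Fintype F] {p n : ℕ} (hF : Fintype.card F = p ^ n)
    (hN : IsPGroup p N) (f : Multiplicative F →* Matrix.SpecialLinearGroup (Fin 2) F) :
    IsPGroup p (unipotentPreimage phi f) := by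
  have h : IsPGroup p (Multiplicative F) :=
    IsPGroup.of_card (n := n) (by
      rw [Nat.card_congr Multiplicative.toAdd, Nat.card_eq_fintype_card, hF])
  have h1 : IsPGroup p f.range := h.of_surjective f.rangeRestrict f.rangeRestrict_surjective
  refine (h1.map phi).comap_of_ker_isPGroup _ ?_
  rwa [QuotientGroup.ker_mk']

lemma relIndex_unipotentPreimage {f : Multiplicative F →* Matrix.SpecialLinearGroup (Fin 2) F}
    (hf : Function.Injective (phi.comp f)) :
    N.relIndex (unipotentPreimage phi f) = Nat.card F := by
  have h : (QuotientGroup.mk' N).ker.relIndex (unipotentPreimage phi f) =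
      Nat.card ((unipotentPreimage phi f).map (QuotientGroup.mk' N)) := by
    rw [Subgroup.relIndex_ker]
  rw [QuotientGroup.ker_mk'] at h
  rw [h, unipotentPreimage,
    Subgroup.map_comap_eq_self_of_surjective (QuotientGroup.mk'_surjective N),
    MonoidHom.map_range, ← Nat.card_congr (MonoidHom.ofInjective hf).toEquiv,
    Nat.card_congr Multiplicative.toAdd]

/-- A proper subgroup above `N` containing the preimage of the upper unipotents meets the
preimage of the lower unipotents in `N`. -/
lemma inf_unipotentPreimage_le (hphi : Function.Surjective phi) {T : Subgroup V} (hNT : N ≤ T)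
    (hT : T ≠ ⊤) (hU : unipotentPreimage phi upperUnipotent ≤ T) :
    T ⊓ unipotentPreimage phi lowerUnipotent ≤ N := by
  rintro g ⟨hgT, -, ⟨c, rfl⟩, hc⟩
  have hcomap : (T.map (QuotientGroup.mk' N)).comap (QuotientGroup.mk' N) = T := by
    rw [Subgroup.comap_map_eq_self]
    rwa [QuotientGroup.ker_mk']
  by_cases hc1 : c = 1
  · rw [hc1, map_one, map_one] at hc
    exact (QuotientGroup.eq_one_iff g).1 hc.symm
  · refine absurd ?_ hT
    have htop : (T.map (QuotientGroup.mk' N)).comap phi = ⊤ := by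
      refine eq_top_of_upperUnipotent_le_of_lowerUnipotent_mem _ ?_ hc1 ⟨g, hgT, hc.symm⟩
      rintro u hu
      obtain ⟨x, hx⟩ := QuotientGroup.mk'_surjective N (phi u)
      exact ⟨x, hU ⟨u, hu, hx.symm⟩, hx⟩
    rw [← hcomap, eq_top_iff]
    intro x _
    obtain ⟨A, hA⟩ := hphi (QuotientGroup.mk' N x)
    have : A ∈ (T.map (QuotientGroup.mk' N)).comap phi := htop ▸ Subgroup.mem_top A
    rw [Subgroup.mem_comap, hA] at this
    exact this

end QuotientSpecialLinear

/-- Step 7 of the proof of the main theorem. Let `V` be a finite perfect group with a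
nontrivial normal elementary abelian `p`-subgroup `N` such that `V/N ≅ SL₂(q)` or
`PSL₂(q)` with `q = pⁿ > 3`. If every linear character of `N` extends to some Sylow
`p`-subgroup of `V`, then some Sylow `p`-subgroup `Q` of `V` has an irreducible
complex character of degree `|Q : N| = q > 1`. -/
theorem step7_sylow_character (p n : ℕ) (hp : p.Prime) (hq : 3 < p ^ n)
    (F : Type*) [Field F] [Fintype F] (hF : Fintype.card F = p ^ n)
    (V : Type) [Group V] [Finite V] (hperf : commutator V = ⊤)
    (N : Subgroup V) [hN : N.Normal] (hNnt : N ≠ ⊥)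
    (hNab : ∀ a b : N, a * b = b * a) (hNelem : ∀ a : N, a ^ p = 1)
    (hiso : Nonempty ((V ⧸ N) ≃* Matrix.SpecialLinearGroup (Fin 2) F) ∨
      Nonempty ((V ⧸ N) ≃* PSL2 F))
    (hext : ∀ lam : N →* ℂˣ, ∃ (R : Sylow p V) (hNR : N ≤ (R : Subgroup V))
      (mu : (R : Subgroup V) →* ℂˣ), ∀ m : N, mu ⟨m, hNR m.2⟩ = lam m) :
    ∃ Q : Sylow p V, ∃ W : FDRep ℂ ↥(Q : Subgroup V), Simple W ∧
      Module.finrank ℂ W = N.relIndex (Q : Subgroup V) ∧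
      N.relIndex (Q : Subgroup V) = p ^ n := by
  have : Fact p.Prime := ⟨hp⟩
  have hn : n ≠ 0 := by rintro rfl; simp at hq
  have hNp : IsPGroup p N := fun a => ⟨1, by rw [pow_one]; exact hNelem a⟩
  obtain ⟨phi₀, hsurj₀, hker₀⟩ : ∃ phi : Matrix.SpecialLinearGroup (Fin 2) F →* V ⧸ N,
      Function.Surjective phi ∧ phi.ker ≤ Subgroup.center _ := by
    obtain ⟨⟨e⟩⟩ | ⟨⟨e⟩⟩ := hiso
    · refine ⟨e.symm.toMonoidHom, e.symm.surjective, ?_⟩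
      rw [(MonoidHom.ker_eq_bot_iff _).2 e.symm.injective]
      exact bot_le
    · refine ⟨e.symm.toMonoidHom.comp (QuotientGroup.mk' _),
        e.symm.surjective.comp (QuotientGroup.mk'_surjective _), ?_⟩
      intro A hA
      exact (QuotientGroup.eq_one_iff A).1 (e.symm.injective (hA.trans (map_one e.symm).symm))
  obtain ⟨lam, hlam⟩ := exists_inertiaSubgroup_ne_top hp hperf N hNnt hNab hNelem hext
  obtain ⟨R, hNR, mu, hmu⟩ := hext lam
  have hRT := le_inertiaSubgroup hNR mu hmu
  -- change coordinates so that `R` is the preimage of the upper unipotents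
  obtain ⟨g, hg⟩ := MulAction.exists_smul_eq V
    ((isPGroup_unipotentPreimage phi₀ hF hNp upperUnipotent).toSylow
      (not_dvd_index_unipotentPreimage phi₀ hp hn hF hsurj₀ upperUnipotent_injective)) R
  let phi := (MulAut.conj (g : V ⧸ N)).toMonoidHom.comp phi₀
  have hsurj : Function.Surjective phi := (MulAut.conj (g : V ⧸ N)).surjective.comp hsurj₀
  have hU : unipotentPreimage phi upperUnipotent ≤ R := by
    rintro x ⟨u, hu, hux⟩
    rw [← hg]
    refine Subgroup.mem_pointwise_smul_iff_inv_smul_mem.2 ⟨u, hu, ?_⟩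
    rw [← map_inv, MulAut.smul_def, MulAut.conj_apply, inv_inv]
    change phi₀ u = ((g⁻¹ * x * g : V) : V ⧸ N)
    change (g : V ⧸ N) * phi₀ u * (g : V ⧸ N)⁻¹ = (x : V ⧸ N) at hux
    rw [QuotientGroup.mk_mul, QuotientGroup.mk_mul, ← hux, QuotientGroup.mk_inv]
    group
  have hinj : Function.Injective (phi.comp lowerUnipotent) := by
    rw [← MonoidHom.ker_eq_bot_iff, eq_bot_iff]
    intro a ha
    have h1 : phi₀ (lowerUnipotent a) = 1 :=
      (MulAut.conj (g : V ⧸ N)).injective (ha.trans (map_one _).symm)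
    exact eq_one_of_lowerUnipotent_mem_center (hker₀ h1)
  let Q : Sylow p V := (isPGroup_unipotentPreimage phi hF hNp lowerUnipotent).toSylow
    (not_dvd_index_unipotentPreimage phi hp hn hF hsurj lowerUnipotent_injective)
  have hNQ : N ≤ (Q : Subgroup V) := hNp.le_sylow_of_normal Q
  have hQ : N.relIndex (Q : Subgroup V) = p ^ n := by
    rw [← hF, ← Nat.card_eq_fintype_card]
    exact relIndex_unipotentPreimage phi hinj
  obtain ⟨W, hW, hdim⟩ := exists_simple_finrank_eq_index (Q : Subgroup V)
    (N.subgroupOf Q) (lam.comp (Subgroup.subgroupOfEquivOfLe hNQ).toMonoidHom) fun x hx => by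
      refine inf_unipotentPreimage_le phi hsurj (hNR.trans hRT) hlam (hU.trans hRT) ⟨?_, x.2⟩
      refine mem_inertiaSubgroup.2 fun m => ?_
      have hm' : x * ⟨m, hNQ m.2⟩ * x⁻¹ ∈ N.subgroupOf Q := by
        rw [Subgroup.mem_subgroupOf]
        exact hN.conj_mem _ m.2 _
      exact hx ⟨m, hNQ m.2⟩ m.2 hm'
  exact ⟨Q, W, hW, hdim, hQ⟩
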